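/- arXiv:1806.09157 — 2 statements merged into one kernel-verified Lean document; each statement's English description precedes it below -/
import Mathlib

section
/- Let E be a real or complex normed vector space, let t ∈ ℝ and τ > 0, and let w : ℝ → E be four times continuously differentiable on [t − 2τ, t] with ‖w⁗(r)‖ ≤ M for all r ∈ [t − 2τ, t]. Then ‖ (1/τ)·( [ (w(t) − w(t − τ))/τ − w′(t − τ/2) ] − [ (w(t − τ) − w(t − 2τ))/τ − w′(t − 3τ/2) ] ) ‖ ≤ Mτ²/24. (This is the estimate on the difference quotient of the truncation error, ‖δₜ( δₜuⁿ − uₜ^{n−1/2} )‖ ≤ Cτ², used in bounding ‖δₜSⁿ‖₀.) -/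
theorem aux_integ {E : Type*} [NormedAddCommGroup E] [NormedSpace ℝ E]
    (h : ℝ) (f f' : ℝ → E) (B B' : ℝ → ℝ)
    (hf : ∀ x ∈ Set.Icc 0 h, HasDerivWithinAt f (f' x) (Set.Icc 0 h) x)
    (h0 : ‖f 0‖ ≤ B 0) (hB : ∀ x, HasDerivAt B (B' x) x)
    (hb : ∀ x ∈ Set.Icc 0 h, ‖f' x‖ ≤ B' x) : ∀ x ∈ Set.Icc 0 h, ‖f x‖ ≤ B x := by
  intro x hx
  refine image_norm_le_of_norm_deriv_right_le_deriv_boundary (f' := f') (a := 0) (b := h)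
    (fun y hy => (hf y hy).continuousWithinAt) ?_ h0 hB ?_ hx
  · intro y hy
    exact (hf y ⟨hy.1, hy.2.le⟩).mono_of_mem_nhdsWithin (Icc_mem_nhdsGE_of_mem hy)
  · intro y hy
    exact hb y ⟨hy.1, hy.2.le⟩

theorem aux_comp {E : Type*} [NormedAddCommGroup E] [NormedSpace ℝ E]
    (f : ℝ → E) (f' : E) (S T : Set ℝ) (u : ℝ → ℝ) (k x : ℝ)
    (hf : HasDerivWithinAt f f' S (u x)) (hu : HasDerivAt u k x) (hm : Set.MapsTo u T S) :
    HasDerivWithinAt (fun y => f (u y)) (k • f') T x :=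
  HasDerivWithinAt.scomp x hf hu.hasDerivWithinAt hm

theorem aux_central {E : Type*} [NormedAddCommGroup E] [NormedSpace ℝ E]
    (c h K : ℝ) (hh : 0 ≤ h) (g g1 g2 g3 : ℝ → E)
    (d0 : ∀ x ∈ Set.Icc (c - h) (c + h), HasDerivWithinAt g (g1 x) (Set.Icc (c - h) (c + h)) x)
    (d1 : ∀ x ∈ Set.Icc (c - h) (c + h), HasDerivWithinAt g1 (g2 x) (Set.Icc (c - h) (c + h)) x)
    (d2 : ∀ x ∈ Set.Icc (c - h) (c + h), HasDerivWithinAt g2 (g3 x) (Set.Icc (c - h) (c + h)) x)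
    (hK : ∀ x ∈ Set.Icc (c - h) (c + h), ‖g3 x‖ ≤ K) :
    ‖g (c + h) - g (c - h) - (2 * h) • g1 c‖ ≤ K * h ^ 3 / 3 := by
  have mp : Set.MapsTo (fun x => c + x) (Set.Icc 0 h) (Set.Icc (c - h) (c + h)) := by
    rintro x ⟨h1, h2⟩; constructor <;> dsimp only <;> linarith
  have mm : Set.MapsTo (fun x => c - x) (Set.Icc 0 h) (Set.Icc (c - h) (c + h)) := by
    rintro x ⟨h1, h2⟩; constructor <;> dsimp only <;> linarith
  have up : ∀ x : ℝ, HasDerivAt (fun x => c + x) 1 x := fun x => (hasDerivAt_id x).const_add c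
  have um : ∀ x : ℝ, HasDerivAt (fun x => c - x) (-1) x := fun x => (hasDerivAt_id x).const_sub c
  have b2 : ∀ x ∈ Set.Icc 0 h, ‖g2 (c + x) - g2 (c - x)‖ ≤ 2 * K * x := by
    intro x hx
    have := (convex_Icc (c - h) (c + h)).norm_image_sub_le_of_norm_hasDerivWithin_le d2 hK
      (mm hx) (mp hx)
    refine this.trans (le_of_eq ?_)
    have : (c + x) - (c - x) = 2 * x := by ring
    simp only [this]
    rw [Real.norm_of_nonneg (by linarith [hx.1])]; ring
  have b1 := aux_integ h (fun x => g1 (c + x) + g1 (c - x) - (2 : ℝ) • g1 c)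
    (fun x => g2 (c + x) - g2 (c - x)) (fun x => K * x ^ 2) (fun x => 2 * K * x)
    (by
      intro x hx
      have := ((aux_comp g1 _ _ _ _ _ x (d1 _ (mp hx)) (up x) mp).add
        (aux_comp g1 _ _ _ _ _ x (d1 _ (mm hx)) (um x) mm)).sub_const ((2 : ℝ) • g1 c)
      refine this.congr_deriv ?_
      module)
    (by simp [two_smul])
    (by
      intro x
      refine ((hasDerivAt_pow 2 x).const_mul K).congr_deriv ?_
      norm_num; ring) b2
  have b0 := aux_integ h (fun x => g (c + x) - g (c - x) - (2 * x) • g1 c)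
    (fun x => g1 (c + x) + g1 (c - x) - (2 : ℝ) • g1 c)
    (fun x => K * x ^ 3 / 3) (fun x => K * x ^ 2)
    (by
      intro x hx
      have := ((aux_comp g _ _ _ _ _ x (d0 _ (mp hx)) (up x) mp).sub
        (aux_comp g _ _ _ _ _ x (d0 _ (mm hx)) (um x) mm)).sub
        ((((hasDerivAt_id x).const_mul 2).smul_const (g1 c)).hasDerivWithinAt (s := Set.Icc 0 h))
      refine this.congr_deriv ?_
      module)
    (by simp)
    (by
      intro x
      refine (((hasDerivAt_pow 3 x).const_mul K).div_const 3).congr_deriv ?_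
      norm_num; ring) b1
  exact b0 h ⟨hh, le_rfl⟩

/-- Estimate on the difference quotient of the Crank–Nicolson truncation error. -/
theorem stmt_13 {E : Type*} [NormedAddCommGroup E] [NormedSpace ℝ E]
    (t τ : ℝ) (hτ : 0 < τ) (w : ℝ → E) (M : ℝ)
    (hw : ContDiffOn ℝ 4 w (Set.Icc (t - 2 * τ) t))
    (hM : ∀ r ∈ Set.Icc (t - 2 * τ) t,
      ‖iteratedDerivWithin 4 w (Set.Icc (t - 2 * τ) t) r‖ ≤ M) :
    ‖τ⁻¹ • ((τ⁻¹ • (w t - w (t - τ))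
          - derivWithin w (Set.Icc (t - 2 * τ) t) (t - τ / 2))
        - (τ⁻¹ • (w (t - τ) - w (t - 2 * τ))
          - derivWithin w (Set.Icc (t - 2 * τ) t) (t - 3 * τ / 2)))‖
      ≤ M * τ ^ 2 / 24 := by
  set S := Set.Icc (t - 2 * τ) t with hS
  have hu : UniqueDiffOn ℝ S := uniqueDiffOn_Icc (by linarith)
  set W : ℕ → ℝ → E := fun k => iteratedDerivWithin k w S with hW
  have dW : ∀ k : ℕ, k < 4 → ∀ x ∈ S, HasDerivWithinAt (W k) (W (k + 1) x) S x := by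
    intro k hk x hx
    have := (hw.differentiableOn_iteratedDerivWithin (m := k) (by exact_mod_cast hk) hu x hx).hasDerivWithinAt
    rw [← iteratedDerivWithin_succ] at this
    exact this
  have e1 : derivWithin w S = W 1 := by
    funext x; simp only [hW, iteratedDerivWithin_one]
  have e0 : w = W 0 := by simp [hW]
  have hc1 : t - τ / 2 - τ / 2 = t - τ := by ring
  have hc2 : t - τ / 2 + τ / 2 = t := by ring
  have m0 : Set.Icc (t - τ) t ⊆ S := Set.Icc_subset_Icc (by linarith) le_rfl
  have m1 : Set.MapsTo (fun x => x - τ) (Set.Icc (t - τ) t) S := by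
    rintro x ⟨h1, h2⟩; constructor <;> dsimp only <;> linarith
  have dg : ∀ k : ℕ, k < 4 → ∀ x ∈ Set.Icc (t - τ) t,
      HasDerivWithinAt (fun x => W k x - W k (x - τ)) (W (k + 1) x - W (k + 1) (x - τ))
        (Set.Icc (t - τ) t) x := by
    intro k hk x hx
    have := ((dW k hk x (m0 hx)).mono m0).sub
      (aux_comp (W k) _ _ _ _ 1 x (dW k hk _ (m1 hx)) ((hasDerivAt_id x).sub_const τ) m1)
    refine this.congr_deriv ?_
    simp
  have hK : ∀ x ∈ Set.Icc (t - τ) t, ‖W 3 x - W 3 (x - τ)‖ ≤ M * τ := by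
    intro x hx
    have := (convex_Icc (t - 2 * τ) t).norm_image_sub_le_of_norm_hasDerivWithin_le
      (dW 3 (by norm_num)) hM (m1 hx) (m0 hx)
    simpa [abs_of_pos hτ] using this
  have key := aux_central (t - τ / 2) (τ / 2) (M * τ) (by linarith)
    (fun x => W 0 x - W 0 (x - τ)) (fun x => W 1 x - W 1 (x - τ))
    (fun x => W 2 x - W 2 (x - τ)) (fun x => W 3 x - W 3 (x - τ))
    (by rw [hc1, hc2]; exact dg 0 (by norm_num)) (by rw [hc1, hc2]; exact dg 1 (by norm_num))
    (by rw [hc1, hc2]; exact dg 2 (by norm_num)) (by rw [hc1, hc2]; exact hK)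
  have a1 : t - τ - τ = t - 2 * τ := by ring
  have a2 : t - τ / 2 - τ = t - 3 * τ / 2 := by ring
  have a3 : 2 * (τ / 2) = τ := by ring
  simp only [hc1, hc2, a1, a2, a3] at key
  rw [e1]
  have e0' : ∀ x, w x = W 0 x := fun x => congrFun e0 x
  rw [e0' t, e0' (t - τ), e0' (t - 2 * τ)]
  generalize W 0 t = A at *
  generalize W 0 (t - τ) = B at *
  generalize W 0 (t - 2 * τ) = C at *
  generalize W 1 (t - τ / 2) = P at *
  generalize W 1 (t - 3 * τ / 2) = Q at *
  have eq : τ⁻¹ • ((τ⁻¹ • (A - B) - P) - (τ⁻¹ • (B - C) - Q))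
      = (τ⁻¹ ^ 2) • (A - B - (B - C) - τ • (P - Q)) := by
    match_scalars <;> field_simp
    all_goals norm_num
  rw [eq, norm_smul, Real.norm_of_nonneg (by positivity)]
  calc τ⁻¹ ^ 2 * ‖A - B - (B - C) - τ • (P - Q)‖
      ≤ τ⁻¹ ^ 2 * (M * τ * (τ / 2) ^ 3 / 3) := by gcongr
    _ = M * τ ^ 2 / 24 := by field_simp; ring
end

section
/- Let E be a real or complex normed vector space, let t ∈ ℝ and τ > 0, and let w : ℝ → E be three times continuously differentiable on [t − 2τ, t] with ‖w‴(r)‖ ≤ M for all r ∈ [t − 2τ, t]. Then ‖ (1/τ)·( [ (w(t) + w(t − τ))/2 − w(t − τ/2) ] − [ (w(t − τ) + w(t − 2τ))/2 − w(t − 3τ/2) ] ) ‖ ≤ Mτ²/8. (This is the estimate on the difference quotient of the averaging error, ‖δₜ( ũⁿ − u^{n−1/2} )‖ ≤ Cτ², used in bounding ‖δₜSⁿ‖₀.) -/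
theorem aux_shift {E : Type*} [NormedAddCommGroup E] [NormedSpace ℝ E]
    {f f' : ℝ → E} {S T : Set ℝ} (hf : ∀ x ∈ S, HasDerivWithinAt f (f' x) S x)
    (c e : ℝ) (x : ℝ) (hx : x ∈ T) (hT : ∀ y ∈ T, c + e * y ∈ S) :
    HasDerivWithinAt (fun y => f (c + e * y)) (e • f' (c + e * x)) T x := by
  have h1 : HasDerivWithinAt (fun y : ℝ => c + e * y) e T x := by
    simpa using (((hasDerivAt_id x).const_mul e).const_add c).hasDerivWithinAt
  exact HasDerivWithinAt.scomp x (hf _ (hT x hx)) h1 hT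

theorem aux_second {E : Type*} [NormedAddCommGroup E] [NormedSpace ℝ E]
    {v u z : ℝ → E} {a b M : ℝ}
    (hv : ∀ x ∈ Set.Icc a b, HasDerivWithinAt v (u x) (Set.Icc a b) x)
    (hu : ∀ x ∈ Set.Icc a b, HasDerivWithinAt u (z x) (Set.Icc a b) x)
    (hz : ∀ x ∈ Set.Icc a b, ‖z x‖ ≤ M) (c h : ℝ) (hh : 0 ≤ h)
    (h1 : a ≤ c - h) (h2 : c + h ≤ b) :
    ‖v (c + h) + v (c - h) - (2 : ℝ) • v c‖ ≤ M * h ^ 2 := by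
  have hp : ∀ y ∈ Set.Icc 0 h, c + 1 * y ∈ Set.Icc a b := by
    rintro y ⟨h3, h4⟩; constructor <;> linarith
  have hm : ∀ y ∈ Set.Icc 0 h, c + (-1) * y ∈ Set.Icc a b := by
    rintro y ⟨h3, h4⟩; constructor <;> linarith
  have hd : ∀ x ∈ Set.Icc 0 h, HasDerivWithinAt
      (fun y => v (c + 1 * y) + v (c + (-1) * y) - (2 : ℝ) • v c)
      ((1 : ℝ) • u (c + 1 * x) + (-1 : ℝ) • u (c + (-1) * x)) (Set.Icc 0 h) x := by
    intro x hx
    exact ((aux_shift hv c 1 x hx hp).add (aux_shift hv c (-1) x hx hm)).sub_const _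
  have key := image_norm_le_of_norm_deriv_right_le_deriv_boundary
    (f := fun y => v (c + 1 * y) + v (c + (-1) * y) - (2 : ℝ) • v c)
    (f' := fun x => (1 : ℝ) • u (c + 1 * x) + (-1 : ℝ) • u (c + (-1) * x))
    (a := 0) (b := h) (B := fun x => M * x ^ 2) (B' := fun x => M * (2 * x))
    (fun x hx => (hd x hx).continuousWithinAt)
    (fun x hx => (hd x ⟨hx.1, hx.2.le⟩).mono_of_mem_nhdsWithin (Icc_mem_nhdsGE_of_mem hx))
    (by simp [two_smul])
    (fun x => by simpa using (hasDerivAt_pow 2 x).const_mul M)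
    (fun x hx => by
      have hx' : x ∈ Set.Icc 0 h := ⟨hx.1, hx.2.le⟩
      have := (convex_Icc a b).norm_image_sub_le_of_norm_hasDerivWithin_le hu hz
        (hm x hx') (hp x hx')
      have e1 : ‖c + 1 * x - (c + (-1) * x)‖ = 2 * x := by
        rw [Real.norm_eq_abs, abs_of_nonneg] <;> linarith [hx.1]
      rw [e1] at this
      simpa [sub_eq_add_neg] using this)
    (x := h) ⟨hh, le_rfl⟩
  simpa [sub_eq_add_neg] using key

/-- Estimate on the difference quotient of the Crank–Nicolson averaging error. -/
theorem stmt_14 {E : Type*} [NormedAddCommGroup E] [NormedSpace ℝ E]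
    (t τ : ℝ) (hτ : 0 < τ) (w : ℝ → E) (M : ℝ)
    (hw : ContDiffOn ℝ 3 w (Set.Icc (t - 2 * τ) t))
    (hM : ∀ r ∈ Set.Icc (t - 2 * τ) t,
      ‖iteratedDerivWithin 3 w (Set.Icc (t - 2 * τ) t) r‖ ≤ M) :
    ‖τ⁻¹ • (((2 : ℝ)⁻¹ • (w t + w (t - τ)) - w (t - τ / 2))
        - ((2 : ℝ)⁻¹ • (w (t - τ) + w (t - 2 * τ)) - w (t - 3 * τ / 2)))‖
      ≤ M * τ ^ 2 / 8 := by
  have hS : UniqueDiffOn ℝ (Set.Icc (t - 2 * τ) t) := uniqueDiffOn_Icc (by linarith)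
  set S := Set.Icc (t - 2 * τ) t with hSdef
  have hD : ∀ n : ℕ, n < 3 → ∀ x ∈ S, HasDerivWithinAt (iteratedDerivWithin n w S)
      (iteratedDerivWithin (n + 1) w S x) S x := by
    intro n hn x hx
    rw [iteratedDerivWithin_succ]
    exact (hw.differentiableOn_iteratedDerivWithin (by exact_mod_cast hn) hS x hx).hasDerivWithinAt
  have h0 := hD 0 (by norm_num)
  have h1 := hD 1 (by norm_num)
  have h2 := hD 2 (by norm_num)
  norm_num only [iteratedDerivWithin_zero] at h0 h1 h2
  set v := iteratedDerivWithin 1 w S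
  have m1 : ∀ y ∈ Set.Icc (t - τ) t, 0 + 1 * y ∈ S := by
    rintro y ⟨h3, h4⟩; constructor <;> linarith
  have m2 : ∀ y ∈ Set.Icc (t - τ) t, -τ + 1 * y ∈ S := by
    rintro y ⟨h3, h4⟩; constructor <;> linarith
  have m3 : ∀ y ∈ Set.Icc (t - τ) t, -(τ / 2) + 1 * y ∈ S := by
    rintro y ⟨h3, h4⟩; constructor <;> linarith
  have key := (convex_Icc (t - τ) t).norm_image_sub_le_of_norm_hasDerivWithin_le
    (f := fun y => (2 : ℝ)⁻¹ • (w (0 + 1 * y) + w (-τ + 1 * y)) - w (-(τ / 2) + 1 * y))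
    (f' := fun y => (2 : ℝ)⁻¹ • ((1 : ℝ) • v (0 + 1 * y) + (1 : ℝ) • v (-τ + 1 * y))
      - (1 : ℝ) • v (-(τ / 2) + 1 * y))
    (C := M * τ ^ 2 / 8) (x := t - τ) (y := t)
    (fun x hx => (((aux_shift h0 0 1 x hx m1).add (aux_shift h0 (-τ) 1 x hx m2)).const_smul
      (2 : ℝ)⁻¹).sub (aux_shift h0 (-(τ / 2)) 1 x hx m3))
    (fun x hx => by
      have k := aux_second h1 h2 hM (x - τ / 2) (τ / 2) (by linarith)
        (by linarith [hx.1]) (by linarith [hx.2])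
      have e : (2 : ℝ)⁻¹ • ((1 : ℝ) • v (0 + 1 * x) + (1 : ℝ) • v (-τ + 1 * x))
          - (1 : ℝ) • v (-(τ / 2) + 1 * x) = (2 : ℝ)⁻¹ • (v (x - τ / 2 + τ / 2)
          + v (x - τ / 2 - τ / 2) - (2 : ℝ) • v (x - τ / 2)) := by
        rw [show 0 + 1 * x = x by ring, show -τ + 1 * x = x - τ by ring,
          show -(τ / 2) + 1 * x = x - τ / 2 by ring, show x - τ / 2 + τ / 2 = x by ring,
          show x - τ / 2 - τ / 2 = x - τ by ring]
        module
      rw [e, norm_smul, norm_inv, Real.norm_of_nonneg (by norm_num : (0 : ℝ) ≤ 2)]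
      linarith)
    ⟨le_rfl, by linarith⟩ ⟨by linarith, le_rfl⟩
  rw [show 0 + 1 * t = t by ring, show -τ + 1 * t = t - τ by ring,
    show -(τ / 2) + 1 * t = t - τ / 2 by ring, show 0 + 1 * (t - τ) = t - τ by ring,
    show -τ + 1 * (t - τ) = t - 2 * τ by ring,
    show -(τ / 2) + 1 * (t - τ) = t - 3 * τ / 2 by ring,
    show t - (t - τ) = τ by ring, Real.norm_of_nonneg hτ.le] at key
  rw [norm_smul, norm_inv, Real.norm_of_nonneg hτ.le, inv_mul_le_iff₀ hτ, mul_comm τ]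
  exact key
end
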